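/- arXiv:2307.00289 — 10 statements merged into one kernel-verified Lean document; each statement's English description precedes it below -/
import Mathlib

section
/- Let A be a finite-dimensional complex Leibniz algebra with dim Ann(A) = m ≠ 0, and dim A = n. Then there exists an (n−m)-dimensional complex Leibniz algebra A', an m-dimensional complex vector space V, and a bilinear map θ : A' × A' → V satisfying the cocycle identity θ(xy,z) = θ(xz,y) + θ(x,yz) and Ann(A') ∩ Ann(θ) = 0, such that A is isomorphic as an algebra to the central extension A'_θ, and the quotient algebra A/Ann(A) is isomorphic to A'. Moreover A' is unique up to isomorphism (it is determined as A/Ann(A)). -/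
noncomputable section

/-- The Leibniz cocycle condition for a bilinear map `θ` with values in `V`:
`θ(xy,z) = θ(xz,y) + θ(x,yz)`. -/
def LeibCocycle {A V : Type*} [AddCommGroup A] [Module ℂ A] [AddCommGroup V] [Module ℂ V]
    (m : A →ₗ[ℂ] A →ₗ[ℂ] A) (θ : A →ₗ[ℂ] A →ₗ[ℂ] V) : Prop :=
  ∀ x y z : A, θ (m x y) z = θ (m x z) y + θ x (m y z)

/-- The (right) Leibniz identity `(xy)z = (xz)y + x(yz)`. -/
def IsLeibniz {A : Type*} [AddCommGroup A] [Module ℂ A] (m : A →ₗ[ℂ] A →ₗ[ℂ] A) : Prop :=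
  LeibCocycle m m

/-- The annihilator of a bilinear map `θ : A × A → V`:
`{x | θ(x,A) = θ(A,x) = 0}`, as a submodule of `A`. -/
def biAnn {A V : Type*} [AddCommGroup A] [Module ℂ A] [AddCommGroup V] [Module ℂ V]
    (θ : A →ₗ[ℂ] A →ₗ[ℂ] V) : Submodule ℂ A where
  carrier := {x | (∀ y, θ x y = 0) ∧ (∀ y, θ y x = 0)}
  add_mem' := by
    rintro a b ⟨ha1, ha2⟩ ⟨hb1, hb2⟩
    refine ⟨fun y => ?_, fun y => ?_⟩
    · simp [ha1 y, hb1 y]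
    · simp [ha2 y, hb2 y]
  zero_mem' := ⟨fun y => by simp, fun y => by simp⟩
  smul_mem' := by
    rintro c a ⟨ha1, ha2⟩
    refine ⟨fun y => ?_, fun y => ?_⟩
    · simp [ha1 y]
    · simp [ha2 y]

/-- The central extension `A_θ` of `A` by `V`: the product on `A ⊕ V` given by
`(x+x')(y+y') = xy + θ(x,y)`. -/
def extMul {A V : Type*} [AddCommGroup A] [Module ℂ A] [AddCommGroup V] [Module ℂ V]
    (m : A →ₗ[ℂ] A →ₗ[ℂ] A) (θ : A →ₗ[ℂ] A →ₗ[ℂ] V) :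
    (A × V) →ₗ[ℂ] (A × V) →ₗ[ℂ] (A × V) :=
  LinearMap.mk₂ ℂ (fun p q => (m p.1 q.1, θ p.1 q.1))
    (fun p p' q => by simp [Prod.ext_iff])
    (fun c p q => by simp [Prod.ext_iff])
    (fun p q q' => by simp [Prod.ext_iff])
    (fun c p q => by simp [Prod.ext_iff])

/-- Every finite-dimensional complex Leibniz algebra `A` with `dim Ann(A) = m ≠ 0` and
`dim A = n` is a central extension of an `(n-m)`-dimensional Leibniz algebra `A'`
(unique up to isomorphism, namely `A' ≅ A/Ann(A)`) by an `m`-dimensional space,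
via a cocycle `θ` with `Ann(A') ∩ Ann(θ) = 0`. -/
theorem statement0 (n m : ℕ) (A : Type) [AddCommGroup A] [Module ℂ A]
    [FiniteDimensional ℂ A]
    (mA : A →ₗ[ℂ] A →ₗ[ℂ] A) (hLeib : IsLeibniz mA)
    (hn : Module.finrank ℂ A = n)
    (hm : Module.finrank ℂ (biAnn mA) = m) (hm0 : m ≠ 0) :
    ∃ (m' : (Fin (n - m) → ℂ) →ₗ[ℂ] (Fin (n - m) → ℂ) →ₗ[ℂ] (Fin (n - m) → ℂ))
      (θ : (Fin (n - m) → ℂ) →ₗ[ℂ] (Fin (n - m) → ℂ) →ₗ[ℂ] (Fin m → ℂ)),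
      -- `A'` is a Leibniz algebra and `θ` is a cocycle
      IsLeibniz m' ∧ LeibCocycle m' θ ∧
      -- `Ann(A') ∩ Ann(θ) = 0`
      biAnn m' ⊓ biAnn θ = ⊥ ∧
      -- `A ≅ A'_θ` as algebras
      (∃ e : A ≃ₗ[ℂ] ((Fin (n - m) → ℂ) × (Fin m → ℂ)),
        ∀ x y : A, e (mA x y) = extMul m' θ (e x) (e y)) ∧
      -- `A/Ann(A) ≅ A'` as algebras
      (∃ q : (A ⧸ biAnn mA) ≃ₗ[ℂ] (Fin (n - m) → ℂ),
        ∀ x y : A, q (Submodule.Quotient.mk (mA x y))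
          = m' (q (Submodule.Quotient.mk x)) (q (Submodule.Quotient.mk y))) ∧
      -- uniqueness of `A'` up to isomorphism: it is determined as `A/Ann(A)`
      (∀ m'' : (Fin (n - m) → ℂ) →ₗ[ℂ] (Fin (n - m) → ℂ) →ₗ[ℂ] (Fin (n - m) → ℂ),
        IsLeibniz m'' →
        (∃ q : (A ⧸ biAnn mA) ≃ₗ[ℂ] (Fin (n - m) → ℂ),
          ∀ x y : A, q (Submodule.Quotient.mk (mA x y))
            = m'' (q (Submodule.Quotient.mk x)) (q (Submodule.Quotient.mk y))) →
        ∃ e : (Fin (n - m) → ℂ) ≃ₗ[ℂ] (Fin (n - m) → ℂ),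
          ∀ x y : Fin (n - m) → ℂ, e (m'' x y) = m' (e x) (e y)) := by
  classical
  have hq : Module.finrank ℂ (A ⧸ biAnn mA) = n - m := by
    have := Submodule.finrank_quotient_add_finrank (biAnn mA)
    omega
  let q : (A ⧸ biAnn mA) ≃ₗ[ℂ] (Fin (n - m) → ℂ) :=
    LinearEquiv.ofFinrankEq _ _ (by simp [hq])
  let v : (biAnn mA) ≃ₗ[ℂ] (Fin m → ℂ) := LinearEquiv.ofFinrankEq _ _ (by simp [hm])
  obtain ⟨p, hp⟩ := (biAnn mA).subtype.exists_leftInverse_of_injective (biAnn mA).ker_subtype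
  have hp' : ∀ x : biAnn mA, p x = x := fun x => LinearMap.congr_fun hp x
  let π : A →ₗ[ℂ] (Fin (n - m) → ℂ) := q.toLinearMap ∘ₗ (biAnn mA).mkQ
  have hπdef : ∀ x, π x = q (Submodule.Quotient.mk x) := fun x => rfl
  have hπ0 : ∀ x, π x = 0 ↔ x ∈ biAnn mA := by
    intro x
    rw [hπdef, LinearEquiv.map_eq_zero_iff, Submodule.Quotient.mk_eq_zero]
  have hπs : Function.Surjective π := q.surjective.comp (biAnn mA).mkQ_surjective
  obtain ⟨s, hs⟩ := π.exists_rightInverse_of_surjective (LinearMap.range_eq_top.2 hπs)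
  have hs' : ∀ x, π (s x) = x := fun x => LinearMap.congr_fun hs x
  have hcong : ∀ a b c d, π a = π c → π b = π d → mA a b = mA c d := by
    intro a b c d h1 h2
    have h1' := (hπ0 (a - c)).1 (by rw [map_sub, h1, sub_self])
    have h2' := (hπ0 (b - d)).1 (by rw [map_sub, h2, sub_self])
    have e1 := h1'.1 b
    have e2 := h2'.2 c
    rw [map_sub, LinearMap.sub_apply, sub_eq_zero] at e1
    rw [map_sub, sub_eq_zero] at e2
    rw [e1, e2]
  let B : (Fin (n - m) → ℂ) →ₗ[ℂ] (Fin (n - m) → ℂ) →ₗ[ℂ] A := mA.compl₁₂ s s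
  have hB : ∀ x y, B (π x) (π y) = mA x y := fun x y => hcong _ _ _ _ (hs' _) (hs' _)
  let m' := B.compr₂ π
  let vp : A →ₗ[ℂ] (Fin m → ℂ) := v.toLinearMap ∘ₗ p
  let θ := B.compr₂ vp
  have hm' : ∀ x y, m' x y = π (B x y) := fun x y => rfl
  have hθ : ∀ x y, θ x y = vp (B x y) := fun x y => rfl
  have hBL : ∀ x y z, B (m' x y) z = B (m' x z) y + B x (m' y z) := by
    intro x y z
    obtain ⟨x, rfl⟩ := hπs x
    obtain ⟨y, rfl⟩ := hπs y
    obtain ⟨z, rfl⟩ := hπs z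
    simp only [hm', hB]
    exact hLeib x y z
  have hker : ∀ a, π a = 0 → vp a = 0 → a = 0 := by
    intro a h1 h2
    have ha := (hπ0 a).1 h1
    have h3 : p a = 0 := v.map_eq_zero_iff.1 h2
    have h4 := hp' ⟨a, ha⟩
    have h5 : (⟨a, ha⟩ : biAnn mA) = 0 := h4.symm.trans h3
    exact congrArg Subtype.val h5
  have hqm : ∀ x y : A, q (Submodule.Quotient.mk (mA x y))
          = m' (q (Submodule.Quotient.mk x)) (q (Submodule.Quotient.mk y)) := by
    intro x y
    simp only [← hπdef, hm', hB]
  refine ⟨m', θ, ?_, ?_, ?_, ?_, ⟨q, hqm⟩, ?_⟩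
  · intro x y z
    rw [hm' (m' x y), hBL, map_add]
    rfl
  · intro x y z
    rw [hθ (m' x y), hBL, map_add]
    rfl
  · rw [eq_bot_iff]
    rintro x ⟨hx1, hx2⟩
    obtain ⟨x, rfl⟩ := hπs x
    refine (hπ0 x).2 ⟨fun y => ?_, fun y => ?_⟩
    · rw [← hB]
      exact hker _ (hx1.1 (π y)) (hx2.1 (π y))
    · rw [← hB]
      exact hker _ (hx1.2 (π y)) (hx2.2 (π y))
  · refine ⟨LinearEquiv.ofBijective (π.prod vp) ⟨?_, ?_⟩, ?_⟩
    · rw [injective_iff_map_eq_zero]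
      intro a ha
      exact hker a (congrArg Prod.fst ha) (congrArg Prod.snd ha)
    · rintro ⟨a, b⟩
      have h0 : ∀ w : biAnn mA, π w = 0 := fun w => (hπ0 w).2 w.2
      have h1 : ∀ w : biAnn mA, vp w = v w := fun w => congrArg v (hp' w)
      refine ⟨s a + ((v.symm (b - vp (s a)) : biAnn mA) : A), ?_⟩
      refine Prod.ext ?_ ?_
      · change π _ = a
        rw [map_add, h0, hs', add_zero]
      · change vp _ = b
        rw [map_add, h1, LinearEquiv.apply_symm_apply, add_sub_cancel]
    · intro x y
      change (π (mA x y), vp (mA x y)) = (π (B (π x) (π y)), vp (B (π x) (π y)))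
      rw [hB]
  · rintro m'' - ⟨q', hq'⟩
    refine ⟨q'.symm.trans q, fun x y => ?_⟩
    obtain ⟨x, rfl⟩ := q'.surjective x
    obtain ⟨y, rfl⟩ := q'.surjective y
    obtain ⟨x, rfl⟩ := Submodule.Quotient.mk_surjective _ x
    obtain ⟨y, rfl⟩ := Submodule.Quotient.mk_surjective _ y
    rw [← hq']
    simp only [LinearEquiv.trans_apply, LinearEquiv.symm_apply_apply]
    exact hqm x y
end
end

section
/- Let A be a finite-dimensional complex Leibniz algebra and V an s-dimensional complex vector space with basis e₁,…,e_s. Let θ(x,y) = Σᵢ θᵢ(x,y)eᵢ and ϑ(x,y) = Σᵢ ϑᵢ(x,y)eᵢ with all θᵢ, ϑᵢ ∈ Z²(A,ℂ), and assume the cohomology classes [θ₁],…,[θ_s] span an s-dimensional subspace W₁ of H²(A,ℂ) with (⋂ᵢ Ann(θᵢ)) ∩ Ann(A) = 0, and likewise [ϑ₁],…,[ϑ_s] span an s-dimensional subspace W₂ with (⋂ᵢ Ann(ϑᵢ)) ∩ Ann(A) = 0. Then the Leibniz algebras A_θ and A_ϑ are isomorphic if and only if there exists an automorphism φ of A such that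 the span of the classes [φθ₁],…,[φθ_s] equals W₂, where (φθᵢ)(x,y) = θᵢ(φ(x),φ(y)). -/
noncomputable section

/-- Assemble `s` scalar-valued bilinear maps `θᵢ` into one bilinear map
`θ(x,y) = (θ₁(x,y), …, θ_s(x,y))` with values in `ℂˢ`. -/
def assemble {A : Type*} [AddCommGroup A] [Module ℂ A] {s : ℕ}
    (θ : Fin s → (A →ₗ[ℂ] A →ₗ[ℂ] ℂ)) : A →ₗ[ℂ] A →ₗ[ℂ] (Fin s → ℂ) :=
  LinearMap.mk₂ ℂ (fun x y i => θ i x y)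
    (fun x x' y => by funext i; simp)
    (fun c x y => by funext i; simp)
    (fun x y y' => by funext i; simp)
    (fun c x y => by funext i; simp)

theorem extMul_assemble_apply {A : Type*} [AddCommGroup A] [Module ℂ A] {s : ℕ}
    (m : A →ₗ[ℂ] A →ₗ[ℂ] A) (θ : Fin s → (A →ₗ[ℂ] A →ₗ[ℂ] ℂ)) (p q : A × (Fin s → ℂ)) :
    extMul m (assemble θ) p q = (m p.1 q.1, fun i => θ i p.1 q.1) := rfl

/-- An isomorphism of central extensions maps the kernel `V` into `V`. -/
theorem iso_fst_zero {A : Type*} [AddCommGroup A] [Module ℂ A] {s : ℕ}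
    (m : A →ₗ[ℂ] A →ₗ[ℂ] A) (θ ϑ : Fin s → (A →ₗ[ℂ] A →ₗ[ℂ] ℂ))
    (hann : (⨅ i, biAnn (ϑ i)) ⊓ biAnn m = ⊥)
    (e : (A × (Fin s → ℂ)) ≃ₗ[ℂ] (A × (Fin s → ℂ)))
    (he : ∀ p q, e (extMul m (assemble θ) p q) = extMul m (assemble ϑ) (e p) (e q))
    (v : Fin s → ℂ) : (e (0, v)).1 = 0 := by
  have h1 : ∀ q, extMul m (assemble ϑ) (e (0, v)) q = 0 := by
    intro q
    have h := he (0, v) (e.symm q)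
    rw [e.apply_symm_apply] at h
    rw [← h, extMul_assemble_apply]
    have : ((m (0 : A) (e.symm q).1, fun i => θ i 0 (e.symm q).1) : A × (Fin s → ℂ)) = 0 := by
      ext <;> simp
    rw [this, map_zero]
  have h2 : ∀ q, extMul m (assemble ϑ) q (e (0, v)) = 0 := by
    intro q
    have h := he (e.symm q) (0, v)
    rw [e.apply_symm_apply] at h
    rw [← h, extMul_assemble_apply]
    have : ((m (e.symm q).1 (0 : A), fun i => θ i (e.symm q).1 0) : A × (Fin s → ℂ)) = 0 := by
      ext <;> simp
    rw [this, map_zero]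
  have hmem : (e (0, v)).1 ∈ (⨅ i, biAnn (ϑ i)) ⊓ biAnn m := by
    refine Submodule.mem_inf.2 ⟨(Submodule.mem_iInf _).2 fun i => ⟨fun y => ?_, fun y => ?_⟩,
      ⟨fun y => ?_, fun y => ?_⟩⟩
    · exact congrFun (congrArg Prod.snd (h1 (y, 0))) i
    · exact congrFun (congrArg Prod.snd (h2 (y, 0))) i
    · exact congrArg Prod.fst (h1 (y, 0))
    · exact congrArg Prod.fst (h2 (y, 0))
  rw [hann] at hmem
  simpa using hmem

/-- Structure of an isomorphism of central extensions. -/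
theorem iso_struct {A : Type*} [AddCommGroup A] [Module ℂ A] {s : ℕ}
    (m : A →ₗ[ℂ] A →ₗ[ℂ] A) (θ ϑ : Fin s → (A →ₗ[ℂ] A →ₗ[ℂ] ℂ))
    (hann : (⨅ i, biAnn (ϑ i)) ⊓ biAnn m = ⊥)
    (e : (A × (Fin s → ℂ)) ≃ₗ[ℂ] (A × (Fin s → ℂ)))
    (he : ∀ p q, e (extMul m (assemble θ) p q) = extMul m (assemble ϑ) (e p) (e q)) :
    (∀ x v, (e (x, v)).1 = (e (x, 0)).1) ∧
    (∀ x y, (e (m x y, 0)).1 = m (e (x, 0)).1 (e (y, 0)).1) ∧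
    (∀ i, ∃ (a : Fin s → ℂ) (f : A →ₗ[ℂ] ℂ), ∀ x y,
      ϑ i (e (x, 0)).1 (e (y, 0)).1 = (∑ j, a j * θ j x y) + f (m x y)) := by
  have hdec : ∀ x v, e (x, v) = e (x, 0) + e (0, v) := by
    intro x v
    rw [← map_add]; simp
  have hfst : ∀ x v, (e (x, v)).1 = (e (x, 0)).1 := by
    intro x v
    rw [hdec, Prod.fst_add, iso_fst_zero m θ ϑ hann e he v, add_zero]
  refine ⟨hfst, fun x y => ?_, fun i => ?_⟩
  · have h := congrArg Prod.fst (he (x, 0) (y, 0))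
    rw [extMul_assemble_apply, extMul_assemble_apply, hfst] at h
    exact h
  · let P : (A × (Fin s → ℂ)) →ₗ[ℂ] ℂ :=
      (LinearMap.proj i).comp ((LinearMap.snd ℂ A (Fin s → ℂ)).comp e.toLinearMap)
    let ψ : (Fin s → ℂ) →ₗ[ℂ] ℂ := P.comp (LinearMap.inr ℂ A (Fin s → ℂ))
    refine ⟨fun j => ψ (Pi.single j 1), P.comp (LinearMap.inl ℂ A (Fin s → ℂ)), fun x y => ?_⟩
    have h := congrFun (congrArg Prod.snd (he (x, 0) (y, 0))) i
    rw [extMul_assemble_apply, extMul_assemble_apply, hdec] at h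
    have h3 : ψ (fun j => θ j x y) = ∑ j, ψ (Pi.single j 1) * θ j x y := by
      rw [LinearMap.pi_apply_eq_sum_univ ψ]
      refine Finset.sum_congr rfl fun j _ => ?_
      rw [smul_eq_mul, mul_comm]
      congr 2
      ext k
      simp [Pi.single_apply, eq_comm]
    rw [← h3, add_comm]
    exact h.symm

/-- `A_θ ≅ A_ϑ` iff some automorphism `φ` of `A` carries the span of the classes
`[θ₁],…,[θ_s]` in `H²(A,ℂ)` onto the span of `[ϑ₁],…,[ϑ_s]`. -/
theorem statement4 (A : Type) [AddCommGroup A] [Module ℂ A] [FiniteDimensional ℂ A]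
    (mA : A →ₗ[ℂ] A →ₗ[ℂ] A) (hLeib : IsLeibniz mA)
    (s : ℕ) (θ ϑ : Fin s → (A →ₗ[ℂ] A →ₗ[ℂ] ℂ))
    -- all `θᵢ`, `ϑᵢ` are cocycles
    (hθc : ∀ i, LeibCocycle mA (θ i)) (hϑc : ∀ i, LeibCocycle mA (ϑ i))
    -- the classes `[θ₁],…,[θ_s]` span an `s`-dimensional subspace of `H²(A,ℂ)`,
    -- i.e. they are linearly independent modulo coboundaries
    (hθind : ∀ a : Fin s → ℂ,
      (∃ f : A →ₗ[ℂ] ℂ, ∀ x y : A, (∑ i, a i * θ i x y) = f (mA x y)) → a = 0)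
    (hϑind : ∀ a : Fin s → ℂ,
      (∃ f : A →ₗ[ℂ] ℂ, ∀ x y : A, (∑ i, a i * ϑ i x y) = f (mA x y)) → a = 0)
    -- `(⋂ᵢ Ann(θᵢ)) ∩ Ann(A) = 0` and likewise for `ϑ`
    (hθann : (⨅ i, biAnn (θ i)) ⊓ biAnn mA = ⊥)
    (hϑann : (⨅ i, biAnn (ϑ i)) ⊓ biAnn mA = ⊥) :
    -- `A_θ ≅ A_ϑ` as algebras …
    (∃ e : (A × (Fin s → ℂ)) ≃ₗ[ℂ] (A × (Fin s → ℂ)),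
       ∀ p q : A × (Fin s → ℂ),
         e (extMul mA (assemble θ) p q) = extMul mA (assemble ϑ) (e p) (e q)) ↔
    -- … iff there is an automorphism `φ` of `A` with
    -- `span([φθ₁],…,[φθ_s]) = span([ϑ₁],…,[ϑ_s])` in `H²(A,ℂ)`
    (∃ φ : A ≃ₗ[ℂ] A,
       (∀ x y : A, φ (mA x y) = mA (φ x) (φ y)) ∧
       (∀ i, ∃ (a : Fin s → ℂ) (f : A →ₗ[ℂ] ℂ),
         ∀ x y : A, θ i (φ x) (φ y) = (∑ j, a j * ϑ j x y) + f (mA x y)) ∧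
       (∀ i, ∃ (a : Fin s → ℂ) (f : A →ₗ[ℂ] ℂ),
         ∀ x y : A, ϑ i x y = (∑ j, a j * θ j (φ x) (φ y)) + f (mA x y))) := by
  constructor
  · rintro ⟨e, he⟩
    have he' : ∀ p q, e.symm (extMul mA (assemble ϑ) p q)
        = extMul mA (assemble θ) (e.symm p) (e.symm q) := by
      intro p q
      rw [LinearEquiv.symm_apply_eq, he]
      simp
    obtain ⟨a1, a2, a3⟩ := iso_struct mA θ ϑ hϑann e he
    obtain ⟨b1, b2, b3⟩ := iso_struct mA ϑ θ hθann e.symm he'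
    have i1 : ∀ x, (e ((e.symm (x, 0)).1, 0)).1 = x := by
      intro x
      rw [← a1 _ (e.symm (x, 0)).2]
      simp
    have i2 : ∀ x, (e.symm ((e (x, 0)).1, 0)).1 = x := by
      intro x
      rw [← b1 _ (e (x, 0)).2]
      simp
    let φ : A ≃ₗ[ℂ] A := LinearEquiv.ofLinear
      ((LinearMap.fst ℂ A (Fin s → ℂ)).comp
        (e.symm.toLinearMap.comp (LinearMap.inl ℂ A (Fin s → ℂ))))
      ((LinearMap.fst ℂ A (Fin s → ℂ)).comp
        (e.toLinearMap.comp (LinearMap.inl ℂ A (Fin s → ℂ))))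
      (LinearMap.ext i2) (LinearMap.ext i1)
    have hφ : ∀ x, φ x = (e.symm (x, 0)).1 := fun x => rfl
    refine ⟨φ, b2, b3, fun i => ?_⟩
    obtain ⟨a, f, h⟩ := a3 i
    refine ⟨a, f.comp φ.toLinearMap, fun x y => ?_⟩
    have h' := h (φ x) (φ y)
    rw [hφ, hφ, i1, i1] at h'
    rw [h']
    simp only [LinearMap.comp_apply, LinearEquiv.coe_coe, hφ, b2]
  · rintro ⟨φ, hφ, h1, h2⟩
    choose a f h1 using h1
    choose b g h2 using h2
    have hBA : ∀ i k, ∑ j, b i j * a j k = (Pi.single i 1 : Fin s → ℂ) k := by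
      intro i k
      have := hϑind (fun k => (∑ j, b i j * a j k) - (Pi.single i 1 : Fin s → ℂ) k)
        ⟨-((∑ j, b i j • f j) + g i), fun x y => ?_⟩
      · exact sub_eq_zero.1 (congrFun this k)
      · have h := h2 i x y
        simp only [h1, mul_add, Finset.sum_add_distrib, Finset.mul_sum] at h
        rw [Finset.sum_comm] at h
        simp only [sub_mul, Finset.sum_sub_distrib, Finset.sum_mul, Pi.single_apply, ite_mul,
          one_mul, zero_mul, Finset.sum_ite_eq', Finset.mem_univ, if_true, LinearMap.neg_apply,
          LinearMap.add_apply, LinearMap.sum_apply, LinearMap.smul_apply, smul_eq_mul, mul_assoc]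
        rw [h]
        ring
    let M : (A × (Fin s → ℂ)) →ₗ[ℂ] (A × (Fin s → ℂ)) :=
      LinearMap.prod (φ.toLinearMap.comp (LinearMap.fst ℂ A (Fin s → ℂ)))
        ((Matrix.mulVecLin (Matrix.of a)).comp (LinearMap.snd ℂ A (Fin s → ℂ)) +
          (LinearMap.pi f).comp (LinearMap.fst ℂ A (Fin s → ℂ)))
    have hM : ∀ p, M p = (φ p.1, fun i => (∑ j, a i j * p.2 j) + f i p.1) := fun p => rfl
    have hinj : Function.Injective M := by
      rw [injective_iff_map_eq_zero]
      rintro ⟨x, v⟩ h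
      rw [hM] at h
      have hx : x = 0 := by
        have := congrArg Prod.fst h
        simpa using this
      subst hx
      have hv : ∀ j, ∑ k, a j k * v k = 0 := by
        intro j
        have := congrFun (congrArg Prod.snd h) j
        simpa using this
      have : v = 0 := by
        funext i
        have h3 : ∑ k, (∑ j, b i j * a j k) * v k = 0 := by
          simp only [Finset.sum_mul, mul_assoc]
          rw [Finset.sum_comm]
          simp only [← Finset.mul_sum, hv, mul_zero, Finset.sum_const_zero]
        simpa [hBA, Pi.single_apply] using h3
      rw [this]; rfl
    let E := LinearEquiv.ofInjectiveEndo M hinj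
    have hE : ∀ p, E p = M p := fun p => rfl
    have hhom : ∀ p q, E (extMul mA (assemble ϑ) p q) = extMul mA (assemble θ) (E p) (E q) := by
      intro p q
      simp only [hE, hM, extMul_assemble_apply, hφ, h1]
    refine ⟨E.symm, fun p q => ?_⟩
    rw [LinearEquiv.symm_apply_eq, hhom]
    simp
end
end

section
/- Let 𝒩₀₁ be the 3-dimensional complex Leibniz algebra with basis e₁,e₂,e₃ and the only nonzero product of basis vectors e₁e₁ = e₂. Then H²(𝒩₀₁,ℂ) has dimension 4, and the classes [Δ₁₃], [Δ₂₁], [Δ₃₁], [Δ₃₃] form a basis of H²(𝒩₀₁,ℂ). -/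
noncomputable section

/-- The bilinear multiplication on `ℂⁿ` determined by structure constants `c`,
with `eᵢ eⱼ = ∑ₖ c i j k • eₖ`. -/
def mulOf {n : ℕ} (c : Fin n → Fin n → Fin n → ℂ) (x y : Fin n → ℂ) : Fin n → ℂ :=
  fun k => ∑ i, ∑ j, x i * y j * c i j k

/-- The bilinear form on `ℂⁿ` determined by the matrix `M`, with `θ(eᵢ,eⱼ) = M i j`. -/
def formOf {n : ℕ} (M : Matrix (Fin n) (Fin n) ℂ) (x y : Fin n → ℂ) : ℂ :=
  ∑ i, ∑ j, x i * M i j * y j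

/-- `M` represents a cocycle: `θ(xy,z) = θ(xz,y) + θ(x,yz)` for all `x,y,z`. -/
def IsCocycle {n : ℕ} (c : Fin n → Fin n → Fin n → ℂ) (M : Matrix (Fin n) (Fin n) ℂ) : Prop :=
  ∀ x y z : Fin n → ℂ,
    formOf M (mulOf c x y) z = formOf M (mulOf c x z) y + formOf M x (mulOf c y z)

/-- The bilinear form `Δ_{ij}` with `Δ_{ij}(e_l,e_m) = δ_{il} δ_{jm}` (as a matrix). -/
def Δ {n : ℕ} (i j : Fin n) : Matrix (Fin n) (Fin n) ℂ :=
  fun l m => if l = i ∧ m = j then 1 else 0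

/-- `H²` of the algebra with structure constants `c` has dimension `d`, and the classes of
the cocycles `M 0, …, M (d-1)` form a basis: each `M i` is a cocycle, and every cocycle `N`
is, for a unique coefficient vector `a`, the sum of `∑ i, a i • M i` and a coboundary
`(x,y) ↦ f(xy)` (where `f` is the linear functional with coefficients `g`). -/
def HBasis {n d : ℕ} (c : Fin n → Fin n → Fin n → ℂ)
    (M : Fin d → Matrix (Fin n) (Fin n) ℂ) : Prop :=
  (∀ i, IsCocycle c (M i)) ∧
  (∀ N : Matrix (Fin n) (Fin n) ℂ, IsCocycle c N →
    ∃! a : Fin d → ℂ, ∃ g : Fin n → ℂ, ∀ x y : Fin n → ℂ,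
      formOf N x y = (∑ i, a i * formOf (M i) x y) + ∑ l, mulOf c x y l * g l)

/-- Every cocycle differs by a coboundary from a cocycle additionally satisfying the
"symmetric" identity `θ(x,yz) = θ(xy,z) + θ(y,xz)`, i.e. `H² = H²_𝒮`. -/
def SymmReduce {n : ℕ} (c : Fin n → Fin n → Fin n → ℂ) : Prop :=
  ∀ N : Matrix (Fin n) (Fin n) ℂ, IsCocycle c N →
    ∃ (N' : Matrix (Fin n) (Fin n) ℂ) (g : Fin n → ℂ),
      IsCocycle c N' ∧
      (∀ x y z : Fin n → ℂ,
        formOf N' x (mulOf c y z) = formOf N' (mulOf c x y) z + formOf N' y (mulOf c x z)) ∧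
      (∀ x y : Fin n → ℂ, formOf N x y = formOf N' x y + ∑ l, mulOf c x y l * g l)

/-- The 3-dimensional Leibniz algebra `𝒩₀₁`: `e₁e₁ = e₂`. -/
def cN01 : Fin 3 → Fin 3 → Fin 3 → ℂ := fun i j k =>
  if i = 0 ∧ j = 0 ∧ k = 1 then 1 else 0

theorem mulOf_cN01 (x y : Fin 3 → ℂ) : mulOf cN01 x y = ![0, x 0 * y 0, 0] := by
  funext k
  match k with
  | 0 | 1 | 2 => simp [mulOf, cN01, Fin.sum_univ_three]

theorem formOf_Δ {n : ℕ} (i j : Fin n) (x y : Fin n → ℂ) :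
    formOf (Δ i j) x y = x i * y j := by
  unfold formOf Δ
  rw [Finset.sum_eq_single i, Finset.sum_eq_single j]
  · rw [if_pos ⟨rfl, rfl⟩, mul_one]
  · intro b _ hb
    rw [if_neg (fun h => hb h.2), mul_zero, zero_mul]
  · intro h
    exact absurd (Finset.mem_univ j) h
  · intro b _ hb
    refine Finset.sum_eq_zero fun m _ => ?_
    rw [if_neg (fun h => hb h.1), mul_zero, zero_mul]
  · intro h
    exact absurd (Finset.mem_univ i) h

/-- `H²(𝒩₀₁,ℂ)` has dimension 4, with basis `[Δ₁₃], [Δ₂₁], [Δ₃₁], [Δ₃₃]`. -/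
theorem statement5 : HBasis cN01 ![Δ 0 2, Δ 1 0, Δ 2 0, Δ 2 2] := by
  refine ⟨?_, ?_⟩
  · intro i x y z
    simp only [mulOf_cN01]
    match i with
    | 0 | 1 | 2 | 3 => simp [formOf_Δ] <;> ring
  · intro N hN
    have h := fun x y z => hN x y z
    simp only [mulOf_cN01] at h
    have h01 := h ![1, 0, 0] ![1, 0, 0] ![1, 0, 0]
    have h11 := h ![0, 1, 0] ![1, 0, 0] ![1, 0, 0]
    have h21 := h ![0, 0, 1] ![1, 0, 0] ![1, 0, 0]
    have h12 := h ![1, 0, 0] ![1, 0, 0] ![0, 0, 1]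
    simp [formOf, Fin.sum_univ_three] at h01 h11 h21 h12
    replace h11 := h11.symm
    replace h21 := h21.symm
    refine ⟨![N 0 2, N 1 0, N 2 0, N 2 2], ⟨![0, N 0 0, 0], ?_⟩, ?_⟩
    · intro x y
      simp only [mulOf_cN01]
      simp [formOf_Δ, Fin.sum_univ_four]
      simp [formOf, Fin.sum_univ_three, h01, h11, h21, h12]
      ring
    · rintro a ⟨g, hg⟩
      simp only [mulOf_cN01] at hg
      have g0 := hg ![1, 0, 0] ![0, 0, 1]
      have g1 := hg ![0, 1, 0] ![1, 0, 0]
      have g2 := hg ![0, 0, 1] ![1, 0, 0]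
      have g3 := hg ![0, 0, 1] ![0, 0, 1]
      simp [formOf_Δ, Fin.sum_univ_four] at g0 g1 g2 g3
      simp [formOf, Fin.sum_univ_three] at g0 g1 g2 g3
      funext k
      match k with
      | 0 | 1 | 2 | 3 => simp [g0, g1, g2, g3]
end
end

section
/- Let 𝒩₀₂ be the 3-dimensional complex Leibniz algebra with basis e₁,e₂,e₃ and nonzero products of basis vectors e₁e₂ = e₃, e₂e₁ = −e₃. Then H²(𝒩₀₂,ℂ) has dimension 5, with basis given by the classes [Δ₁₁], [Δ₁₂], [Δ₁₃−Δ₃₁], [Δ₂₂], [Δ₂₃−Δ₃₂]; moreover every cocycle θ ∈ Z²(𝒩₀₂,ℂ) differs by a coboundary from a cocycle satisfying θ(x,yz) = θ(xy,z) + θ(y,xz) for all x,y,z (i.e. H²(𝒩₀₂,ℂ) = H²_𝒮(𝒩₀₂,ℂ)). -/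
noncomputable section

/-- The 3-dimensional Leibniz algebra `𝒩₀₂`: `e₁e₂ = e₃`, `e₂e₁ = -e₃`. -/
def cN02 : Fin 3 → Fin 3 → Fin 3 → ℂ := fun i j k =>
  (if i = 0 ∧ j = 1 ∧ k = 2 then 1 else 0) +
  (if i = 1 ∧ j = 0 ∧ k = 2 then -1 else 0)

theorem mulOf_eq (x y : Fin 3 → ℂ) :
    mulOf cN02 x y = ![0, 0, x 0 * y 1 - x 1 * y 0] := by
  funext k
  revert k
  simp [Fin.forall_fin_succ, mulOf, cN02, Fin.sum_univ_three]
  ring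

theorem formOf_eq (M : Matrix (Fin 3) (Fin 3) ℂ) (x y : Fin 3 → ℂ) :
    formOf M x y = x 0 * M 0 0 * y 0 + x 0 * M 0 1 * y 1 + x 0 * M 0 2 * y 2
      + x 1 * M 1 0 * y 0 + x 1 * M 1 1 * y 1 + x 1 * M 1 2 * y 2
      + x 2 * M 2 0 * y 0 + x 2 * M 2 1 * y 1 + x 2 * M 2 2 * y 2 := by
  simp [formOf, Fin.sum_univ_three]; ring

theorem cocycle_iff (M : Matrix (Fin 3) (Fin 3) ℂ) :
    IsCocycle cN02 M ↔ M 2 2 = 0 ∧ M 2 0 = - M 0 2 ∧ M 2 1 = - M 1 2 := by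
  constructor
  · intro h
    have h1 := h ![1, 0, 0] ![0, 1, 0] ![0, 0, 1]
    have h2 := h ![1, 0, 0] ![1, 0, 0] ![0, 1, 0]
    have h3 := h ![0, 1, 0] ![0, 1, 0] ![1, 0, 0]
    simp [mulOf_eq, formOf_eq] at h1 h2 h3
    refine ⟨h1, ?_, ?_⟩
    · linear_combination -h2
    · linear_combination h3
  · rintro ⟨h1, h2, h3⟩ x y z
    simp [mulOf_eq, formOf_eq, h1, h2, h3]
    ring

theorem sum_basis (a : Fin 5 → ℂ) (x y : Fin 3 → ℂ) :
    (∑ i, a i * formOf ((![Δ 0 0, Δ 0 1, Δ 0 2 - Δ 2 0, Δ 1 1, Δ 1 2 - Δ 2 1] :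
        Fin 5 → Matrix (Fin 3) (Fin 3) ℂ) i) x y) =
      a 0 * (x 0 * y 0) + a 1 * (x 0 * y 1) + a 2 * (x 0 * y 2 - x 2 * y 0)
        + a 3 * (x 1 * y 1) + a 4 * (x 1 * y 2 - x 2 * y 1) := by
  rw [Fin.sum_univ_five]
  change a 0 * formOf (Δ 0 0) x y + a 1 * formOf (Δ 0 1) x y
    + a 2 * formOf (Δ 0 2 - Δ 2 0) x y + a 3 * formOf (Δ 1 1) x y
    + a 4 * formOf (Δ 1 2 - Δ 2 1) x y = _
  simp [formOf_eq, Δ]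
  ring

/-- `H²(𝒩₀₂,ℂ)` has dimension 5, with basis
`[Δ₁₁], [Δ₁₂], [Δ₁₃-Δ₃₁], [Δ₂₂], [Δ₂₃-Δ₃₂]`; moreover `H²(𝒩₀₂,ℂ) = H²_𝒮(𝒩₀₂,ℂ)`. -/
theorem statement6 :
    HBasis cN02 ![Δ 0 0, Δ 0 1, Δ 0 2 - Δ 2 0, Δ 1 1, Δ 1 2 - Δ 2 1] ∧
    SymmReduce cN02 := by
  refine ⟨⟨?_, ?_⟩, ?_⟩
  · have c0 : IsCocycle cN02 (Δ 0 0) := by rw [cocycle_iff]; simp [Δ]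
    have c1 : IsCocycle cN02 (Δ 0 1) := by rw [cocycle_iff]; simp [Δ]
    have c2 : IsCocycle cN02 (Δ 0 2 - Δ 2 0) := by rw [cocycle_iff]; simp [Δ]
    have c3 : IsCocycle cN02 (Δ 1 1) := by rw [cocycle_iff]; simp [Δ]
    have c4 : IsCocycle cN02 (Δ 1 2 - Δ 2 1) := by rw [cocycle_iff]; simp [Δ]
    intro i
    fin_cases i
    exacts [c0, c1, c2, c3, c4]
  · intro N hN
    obtain ⟨h1, h2, h3⟩ := (cocycle_iff N).1 hN
    refine ⟨![N 0 0, N 0 1 + N 1 0, N 0 2, N 1 1, N 1 2], ⟨![0, 0, -N 1 0], ?_⟩, ?_⟩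
    · intro x y
      rw [sum_basis]
      simp [Fin.sum_univ_three, mulOf_eq, formOf_eq, h1, h2, h3]
      ring
    · rintro a ⟨g, hg⟩
      have e00 := hg ![1, 0, 0] ![1, 0, 0]
      have e01 := hg ![1, 0, 0] ![0, 1, 0]
      have e10 := hg ![0, 1, 0] ![1, 0, 0]
      have e02 := hg ![1, 0, 0] ![0, 0, 1]
      have e11 := hg ![0, 1, 0] ![0, 1, 0]
      have e12 := hg ![0, 1, 0] ![0, 0, 1]
      simp only [sum_basis] at e00 e01 e10 e02 e11 e12
      simp [Fin.sum_univ_three, mulOf_eq, formOf_eq]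
        at e00 e01 e10 e02 e11 e12
      rw [funext_iff]
      intro i
      revert i
      simp [Fin.forall_fin_succ, e00, e01, e10, e02, e11, e12]
  · intro N hN
    obtain ⟨h1, h2, h3⟩ := (cocycle_iff N).1 hN
    refine ⟨N, 0, hN, ?_, ?_⟩
    · intro x y z
      simp [mulOf_eq, formOf_eq, h1, h2, h3]
      ring
    · intro x y
      simp
end
end

section
/- For α ∈ ℂ, let 𝒩₀₃^α be the 3-dimensional complex Leibniz algebra with basis e₁,e₂,e₃ and nonzero products of basis vectors e₁e₁ = e₃, e₁e₂ = e₃, e₂e₂ = αe₃. If α ≠ 0, then H²(𝒩₀₃^α,ℂ) has dimension 3 with basis the classes [Δ₁₁], [Δ₂₁], [Δ₂₂]; if α = 0, then H²(𝒩₀₃^0,ℂ) has dimension 4 with basis the classes [Δ₁₁], [Δ₂₁], [Δ₂₂], [Δ₃₁+Δ₃₂]. -/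
noncomputable section

/-- The 3-dimensional Leibniz algebra `𝒩₀₃^α`: `e₁e₁ = e₃`, `e₁e₂ = e₃`, `e₂e₂ = αe₃`. -/
def cN03 (α : ℂ) : Fin 3 → Fin 3 → Fin 3 → ℂ := fun i j k =>
  (if i = 0 ∧ j = 0 ∧ k = 2 then 1 else 0) +
  (if i = 0 ∧ j = 1 ∧ k = 2 then 1 else 0) +
  (if i = 1 ∧ j = 1 ∧ k = 2 then α else 0)

lemma delta_apply (i j l m : Fin 3) :
    (Δ i j : Matrix (Fin 3) (Fin 3) ℂ) l m = if l = i ∧ m = j then 1 else 0 := rfl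

lemma mul_cN03 (α : ℂ) (x y : Fin 3 → ℂ) :
    mulOf (cN03 α) x y = ![0, 0, x 0 * y 0 + x 0 * y 1 + α * (x 1 * y 1)] := by
  funext k
  fin_cases k <;> simp [mulOf, cN03, Fin.sum_univ_three]
  ring

lemma form_three (M : Matrix (Fin 3) (Fin 3) ℂ) (x y : Fin 3 → ℂ) :
    formOf M x y = x 0 * M 0 0 * y 0 + x 0 * M 0 1 * y 1 + x 0 * M 0 2 * y 2 +
      (x 1 * M 1 0 * y 0 + x 1 * M 1 1 * y 1 + x 1 * M 1 2 * y 2) +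
      (x 2 * M 2 0 * y 0 + x 2 * M 2 1 * y 1 + x 2 * M 2 2 * y 2) := by
  simp [formOf, Fin.sum_univ_three]

/-- Entries of a cocycle of `𝒩₀₃^α`. -/
lemma cocycle_entries (α : ℂ) (N : Matrix (Fin 3) (Fin 3) ℂ) (h : IsCocycle (cN03 α) N) :
    N 0 2 = 0 ∧ N 1 2 = 0 ∧ N 2 2 = 0 ∧ N 2 1 = N 2 0 ∧ α * N 2 0 = 0 := by
  unfold IsCocycle at h
  simp only [mul_cN03, form_three] at h
  have h1 := h ![1, 0, 0] ![1, 0, 0] ![1, 0, 0]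
  have h2 := h ![0, 1, 0] ![1, 0, 0] ![1, 0, 0]
  have h3 := h ![0, 0, 1] ![1, 0, 0] ![1, 0, 0]
  have h4 := h ![1, 0, 0] ![1, 0, 0] ![0, 1, 0]
  have h5 := h ![0, 1, 0] ![1, 0, 0] ![0, 1, 0]
  simp at h1 h2 h3 h4 h5
  refine ⟨h1, h2.symm, h3.symm, ?_, ?_⟩
  · rw [h4, h1]; ring
  · linear_combination -h5 + h2

theorem statement7 (α : ℂ) :
    (α ≠ 0 → HBasis (cN03 α) ![Δ 0 0, Δ 1 0, Δ 1 1]) ∧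
    (α = 0 → HBasis (cN03 0) ![Δ 0 0, Δ 1 0, Δ 1 1, Δ 2 0 + Δ 2 1]) := by
  constructor
  · intro hα
    refine ⟨?_, ?_⟩
    · intro i x y z
      fin_cases i <;> simp [mul_cN03, form_three, delta_apply]
    · intro N hN
      obtain ⟨h1, h2, h3, h4, h5⟩ := cocycle_entries α N hN
      have h6 : N 2 0 = 0 := by simpa [hα] using h5
      rw [h6] at h4
      refine ⟨![N 0 0 - N 0 1, N 1 0, N 1 1 - α * N 0 1], ⟨![0, 0, N 0 1], ?_⟩, ?_⟩
      · intro x y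
        simp [mul_cN03, Fin.sum_univ_three]
        simp [form_three, delta_apply, h1, h2, h3, h4, h6]
        ring
      · rintro a ⟨g, hg⟩
        simp [mul_cN03, Fin.sum_univ_three] at hg
        simp only [form_three] at hg
        have g1 := hg ![1, 0, 0] ![1, 0, 0]
        have g2 := hg ![1, 0, 0] ![0, 1, 0]
        have g3 := hg ![0, 1, 0] ![1, 0, 0]
        have g4 := hg ![0, 1, 0] ![0, 1, 0]
        simp [delta_apply] at g1 g2 g3 g4
        funext i
        fin_cases i <;> simp [g1, g2, g3, g4]
  · intro _
    refine ⟨?_, ?_⟩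
    · intro i x y z
      fin_cases i <;> simp [mul_cN03, form_three, delta_apply]
      ring
    · intro N hN
      obtain ⟨h1, h2, h3, h4, -⟩ := cocycle_entries 0 N hN
      refine ⟨![N 0 0 - N 0 1, N 1 0, N 1 1, N 2 0], ⟨![0, 0, N 0 1], ?_⟩, ?_⟩
      · intro x y
        simp [mul_cN03, Fin.sum_univ_three, Fin.sum_univ_four]
        simp [form_three, delta_apply, h1, h2, h3, h4]
        ring
      · rintro a ⟨g, hg⟩
        simp [mul_cN03, Fin.sum_univ_three, Fin.sum_univ_four] at hg
        simp only [form_three] at hg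
        have g1 := hg ![1, 0, 0] ![1, 0, 0]
        have g2 := hg ![1, 0, 0] ![0, 1, 0]
        have g3 := hg ![0, 1, 0] ![1, 0, 0]
        have g4 := hg ![0, 1, 0] ![0, 1, 0]
        have g5 := hg ![0, 0, 1] ![1, 0, 0]
        simp [delta_apply] at g1 g2 g3 g4 g5
        funext i
        fin_cases i <;> simp [g1, g2, g3, g4, g5]
end
end

section
/- Let 𝔑₀₁ be the 4-dimensional complex Leibniz algebra with basis e₁,e₂,e₃,e₄ and the only nonzero product of basis vectors e₁e₁ = e₂. Then H²(𝔑₀₁,ℂ) has dimension 9, with basis given by the classes [Δ₁₃], [Δ₁₄], [Δ₂₁], [Δ₃₁], [Δ₃₃], [Δ₃₄], [Δ₄₁], [Δ₄₃], [Δ₄₄]. -/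
noncomputable section

/-- The 4-dimensional Leibniz algebra `𝔑₀₁`: `e₁e₁ = e₂`. -/
def cM01 : Fin 4 → Fin 4 → Fin 4 → ℂ := fun i j k =>
  if i = 0 ∧ j = 0 ∧ k = 1 then 1 else 0

theorem mulOf_cM01 (x y : Fin 4 → ℂ) : mulOf cM01 x y = ![0, x 0 * y 0, 0, 0] := by
  funext k
  fin_cases k <;> simp [mulOf, cM01, Fin.sum_univ_four]

theorem formOf_delta (i j : Fin 4) (x y : Fin 4 → ℂ) : formOf (Δ i j) x y = x i * y j := by
  fin_cases i <;> fin_cases j <;> simp [formOf, Δ, Fin.sum_univ_four]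

theorem formOf_single (M : Matrix (Fin 4) (Fin 4) ℂ) (i j : Fin 4) :
    formOf M (Pi.single i 1) (Pi.single j 1) = M i j := by
  simp [formOf, Pi.single_apply]

/-- `H²(𝔑₀₁,ℂ)` has dimension 9, with basis
`[Δ₁₃], [Δ₁₄], [Δ₂₁], [Δ₃₁], [Δ₃₃], [Δ₃₄], [Δ₄₁], [Δ₄₃], [Δ₄₄]`. -/
theorem statement8 :
    HBasis cM01 ![Δ 0 2, Δ 0 3, Δ 1 0, Δ 2 0, Δ 2 2, Δ 2 3, Δ 3 0, Δ 3 2, Δ 3 3] := by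
  refine ⟨?_, ?_⟩
  · intro i x y z
    fin_cases i <;> simp [mulOf_cM01, formOf_delta] <;> ring
  · intro N hN
    have h1 : ∀ i, N i 1 = 0 := by
      intro i
      have h := hN (Pi.single i 1) (Pi.single 0 1) (Pi.single 0 1)
      rw [left_eq_add, mulOf_cM01] at h
      rw [← formOf_single N i 1, ← h]
      congr 1
      funext k
      fin_cases k <;> simp
    have h2 : ∀ j, j ≠ 0 → N 1 j = 0 := by
      intro j hj
      have h := hN (Pi.single 0 1) (Pi.single 0 1) (Pi.single j 1)
      simp only [mulOf_cM01] at h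
      simpa [formOf, Fin.sum_univ_four, Pi.single_apply, hj, hj.symm] using h
    have h12 := h2 2 (by decide)
    have h13 := h2 3 (by decide)
    refine ⟨![N 0 2, N 0 3, N 1 0, N 2 0, N 2 2, N 2 3, N 3 0, N 3 2, N 3 3],
      ⟨![0, N 0 0, 0, 0], ?_⟩, ?_⟩
    · intro x y
      simp [Fin.sum_univ_succ, mulOf_cM01, formOf_delta]
      simp [formOf, Fin.sum_univ_four, h1, h12, h13]
      ring
    · rintro a ⟨g, hg⟩
      have key : ∀ i j, N i j = _ := fun i j =>
        (formOf_single N i j).symm.trans (hg (Pi.single i 1) (Pi.single j 1))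
      simp only [mulOf_cM01] at key
      funext k
      fin_cases k
      · simp [key 0 2, Fin.sum_univ_succ, formOf_delta]
      · simp [key 0 3, Fin.sum_univ_succ, formOf_delta]
      · simp [key 1 0, Fin.sum_univ_succ, formOf_delta]
      · simp [key 2 0, Fin.sum_univ_succ, formOf_delta]
      · simp [key 2 2, Fin.sum_univ_succ, formOf_delta]
      · simp [key 2 3, Fin.sum_univ_succ, formOf_delta]
      · simp [key 3 0, Fin.sum_univ_succ, formOf_delta]
      · simp [key 3 2, Fin.sum_univ_succ, formOf_delta]
      · simp [key 3 3, Fin.sum_univ_succ, formOf_delta]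
end
end

section
/- Let 𝔏₁₃ be the 4-dimensional complex Leibniz algebra with basis e₁,e₂,e₃,e₄ and nonzero products of basis vectors e₁e₁ = e₂, e₂e₁ = e₃, e₃e₁ = e₄. Then H²(𝔏₁₃,ℂ) has dimension 1, spanned by the class [Δ₄₁]. -/
noncomputable section

/-- The 4-dimensional Leibniz algebra `𝔏₁₃`: `e₁e₁ = e₂`, `e₂e₁ = e₃`, `e₃e₁ = e₄`. -/
def cL13 : Fin 4 → Fin 4 → Fin 4 → ℂ := fun i j k =>
  (if i = 0 ∧ j = 0 ∧ k = 1 then 1 else 0) +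
  (if i = 1 ∧ j = 0 ∧ k = 2 then 1 else 0) +
  (if i = 2 ∧ j = 0 ∧ k = 3 then 1 else 0)

/-- Explicit multiplication of `𝔏₁₃`. -/
theorem mul_cL13 (x y : Fin 4 → ℂ) :
    mulOf cL13 x y = ![0, x 0 * y 0, x 1 * y 0, x 2 * y 0] := by
  funext k
  fin_cases k <;> simp [mulOf, cL13, Fin.sum_univ_four]

/-- The form of `Δ₄₁`. -/
theorem form_Δ41 (x y : Fin 4 → ℂ) : formOf (Δ 3 0) x y = x 3 * y 0 := by
  simp [formOf, Δ, Fin.sum_univ_four]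

/-- `H²(𝔏₁₃,ℂ)` has dimension 1, spanned by the class `[Δ₄₁]`. -/
theorem statement15 : HBasis cL13 ![Δ 3 0] := by
  constructor
  · intro i x y z
    fin_cases i
    simp [form_Δ41, mul_cL13]
    ring
  · intro N hN
    -- values of the cocycle on pairs of basis vectors
    have hval : ∀ i j, formOf N (Pi.single i 1) (Pi.single j 1) = N i j := by
      intro i j
      simp [formOf, Pi.single_apply]
    have h1 : ∀ i, N i 1 = 0 := by
      intro i
      have h := hN (Pi.single i 1) (Pi.single 0 1) (Pi.single 0 1)
      have e : mulOf cL13 (Pi.single 0 1) (Pi.single 0 1) = Pi.single 1 1 := by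
        rw [mul_cL13]; funext k; fin_cases k <;> simp
      rw [e, hval] at h
      simpa using h
    have h2 : ∀ i, N i 2 = 0 := by
      intro i
      have h := hN (Pi.single i 1) (Pi.single 1 1) (Pi.single 0 1)
      have e : mulOf cL13 (Pi.single 1 1) (Pi.single 0 1) = Pi.single 2 1 := by
        rw [mul_cL13]; funext k; fin_cases k <;> simp
      rw [e, hval] at h
      simpa [mul_cL13, formOf, Fin.sum_univ_four, h1] using h.symm
    have h3 : ∀ i, N i 3 = 0 := by
      intro i
      have h := hN (Pi.single i 1) (Pi.single 2 1) (Pi.single 0 1)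
      have e : mulOf cL13 (Pi.single 2 1) (Pi.single 0 1) = Pi.single 3 1 := by
        rw [mul_cL13]; funext k; fin_cases k <;> simp
      rw [e, hval] at h
      simpa [mul_cL13, formOf, Fin.sum_univ_four, h2] using h.symm
    refine ⟨fun _ => N 3 0, ⟨![0, N 0 0, N 1 0, N 2 0], ?_⟩, ?_⟩
    · intro x y
      simp [Δ, mul_cL13, formOf, Fin.sum_univ_four, h1, h2, h3]
      ring
    · rintro a ⟨g, hg⟩
      funext i
      have h := hg (Pi.single 3 1) (Pi.single 0 1)
      rw [hval] at h
      fin_cases i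
      simpa [form_Δ41, mul_cL13, Fin.sum_univ_four] using h.symm
end
end

section
/- Let 𝒩₀₁ be the 3-dimensional complex Leibniz algebra with basis e₁,e₂,e₃ and the only nonzero product of basis vectors e₁e₁ = e₂. A linear automorphism φ of 𝒩₀₁ is an algebra automorphism (φ(ab) = φ(a)φ(b) for all a,b) if and only if there exist x,y,z,u,t ∈ ℂ with x ≠ 0 and t ≠ 0 such that φ(e₁) = xe₁ + ye₂ + ze₃, φ(e₂) = x²e₂, and φ(e₃) = ue₂ + te₃. -/
noncomputable section

theorem mulOf_cN01_s16 (a b : Fin 3 → ℂ) :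
    mulOf cN01 a b = (a 0 * b 0) • (Pi.single 1 1 : Fin 3 → ℂ) := by
  funext k
  fin_cases k <;> simp [mulOf, cN01, Fin.sum_univ_three]

theorem vec3_eq (a : Fin 3 → ℂ) :
    a = a 0 • (Pi.single 0 1 : Fin 3 → ℂ) + a 1 • (Pi.single 1 1 : Fin 3 → ℂ)
      + a 2 • (Pi.single 2 1 : Fin 3 → ℂ) := by
  funext k
  fin_cases k <;> simp

/-- A linear automorphism `φ` of `𝒩₀₁` is an algebra automorphism iff there are
`x,y,z,u,t ∈ ℂ`, `x ≠ 0`, `t ≠ 0`, with `φ(e₁) = xe₁ + ye₂ + ze₃`, `φ(e₂) = x²e₂`,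
`φ(e₃) = ue₂ + te₃`. -/
theorem statement16 (φ : (Fin 3 → ℂ) ≃ₗ[ℂ] (Fin 3 → ℂ)) :
    (∀ a b : Fin 3 → ℂ, φ (mulOf cN01 a b) = mulOf cN01 (φ a) (φ b)) ↔
    (∃ x y z u t : ℂ, x ≠ 0 ∧ t ≠ 0 ∧
      φ (Pi.single 0 1) =
        x • (Pi.single 0 1 : Fin 3 → ℂ) + y • (Pi.single 1 1 : Fin 3 → ℂ)
          + z • (Pi.single 2 1 : Fin 3 → ℂ) ∧
      φ (Pi.single 1 1) = (x ^ 2) • (Pi.single 1 1 : Fin 3 → ℂ) ∧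
      φ (Pi.single 2 1) =
        u • (Pi.single 1 1 : Fin 3 → ℂ) + t • (Pi.single 2 1 : Fin 3 → ℂ)) := by
  simp only [mulOf_cN01_s16, map_smul]
  constructor
  · intro h
    have h1 : φ (Pi.single 1 1) =
        ((φ (Pi.single 0 1) 0) ^ 2) • (Pi.single 1 1 : Fin 3 → ℂ) := by
      have := h (Pi.single 0 1) (Pi.single 0 1)
      simpa [sq] using this
    have hx : φ (Pi.single 0 1) 0 ≠ 0 := by
      intro h0
      rw [h0] at h1
      have h2 : (Pi.single 1 1 : Fin 3 → ℂ) = 0 := by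
        apply φ.injective
        rw [h1]
        simp
      have := congrFun h2 1
      simp at this
    have h20 : φ (Pi.single 2 1) 0 = 0 := by
      have := congrFun (h (Pi.single 2 1) (Pi.single 2 1)) 1
      simpa using this
    have h2 : φ (Pi.single 2 1) = φ (Pi.single 2 1) 1 • (Pi.single 1 1 : Fin 3 → ℂ)
        + φ (Pi.single 2 1) 2 • (Pi.single 2 1 : Fin 3 → ℂ) := by
      have := vec3_eq (φ (Pi.single 2 1))
      rw [h20, zero_smul, zero_add] at this
      exact this
    refine ⟨_, _, _, _, _, hx, ?_, vec3_eq _, h1, h2⟩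
    intro ht
    rw [ht, zero_smul, add_zero] at h2
    generalize φ (Pi.single 2 1) 1 = u at h2
    have h3 : ((φ (Pi.single 0 1) 0) ^ 2) • (Pi.single 2 1 : Fin 3 → ℂ)
        = u • (Pi.single 1 1 : Fin 3 → ℂ) := by
      apply φ.injective
      rw [map_smul, map_smul, h2, h1, smul_smul, smul_smul, mul_comm]
    have := congrFun h3 2
    simp at this
    exact hx this
  · rintro ⟨x, y, z, u, t, -, -, h0, h1, h2⟩ a b
    have key : ∀ a : Fin 3 → ℂ, φ a 0 = a 0 * x := by
      intro a
      conv_lhs => rw [vec3_eq a]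
      simp only [map_add, map_smul, h0, h1, h2]
      simp
    rw [key, key, h1, smul_smul]
    congr 1
    ring
end
end

section
/- Let 𝕃₄₆ be the 5-dimensional complex algebra with basis e₁,…,e₅ and nonzero products of basis vectors e₁e₂ = e₃, e₂e₁ = e₄, e₂e₂ = −e₃, e₃e₂ = e₅, e₄e₁ = e₅. Then 𝕃₄₆ is a nilpotent Leibniz algebra (it satisfies (xy)z = (xz)y + x(yz) for all x,y,z, and every product of 5 elements, with any arrangement of parentheses, vanishes), and 𝕃₄₆ is not a symmetric Leibniz algebra: there exist x,y,z ∈ 𝕃₄₆ with x(yz) ≠ (xy)z + y(xz) (for instance x = y = z = e₂). -/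
noncomputable section

/-- `IsProd mul p v` : `v` is a product of `p` elements of the algebra,
under some arrangement of parentheses. -/
inductive IsProd {V : Type*} (mul : V → V → V) : ℕ → V → Prop
  | single (v : V) : IsProd mul 1 v
  | mul {p q : ℕ} {x y : V} : IsProd mul p x → IsProd mul q y → IsProd mul (p + q) (mul x y)

/-- The 5-dimensional algebra `𝕃₄₆`:
`e₁e₂ = e₃`, `e₂e₁ = e₄`, `e₂e₂ = -e₃`, `e₃e₂ = e₅`, `e₄e₁ = e₅`. -/
def cL46 : Fin 5 → Fin 5 → Fin 5 → ℂ := fun i j k =>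
  (if i = 0 ∧ j = 1 ∧ k = 2 then 1 else 0) +
  (if i = 1 ∧ j = 0 ∧ k = 3 then 1 else 0) +
  (if i = 1 ∧ j = 1 ∧ k = 2 then -1 else 0) +
  (if i = 2 ∧ j = 1 ∧ k = 4 then 1 else 0) +
  (if i = 3 ∧ j = 0 ∧ k = 4 then 1 else 0)

theorem mulOf_cL46 (x y : Fin 5 → ℂ) :
    mulOf cL46 x y = ![0, 0, x 0 * y 1 - x 1 * y 1, x 1 * y 0, x 2 * y 1 + x 3 * y 0] := by
  funext k
  fin_cases k <;> simp [mulOf, cL46, Fin.sum_univ_five] <;> ring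

theorem isProd_cL46 {p : ℕ} {v : Fin 5 → ℂ} (h : IsProd (mulOf cL46) p v) :
    1 ≤ p ∧ (2 ≤ p → v 0 = 0 ∧ v 1 = 0) ∧ (3 ≤ p → v 2 = 0 ∧ v 3 = 0) ∧
      (4 ≤ p → v 4 = 0) := by
  induction h with
  | single v => simp
  | @mul p q x y _ _ hx hy =>
    obtain ⟨hp, hx2, hx3, -⟩ := hx
    obtain ⟨hq, hy2, -, -⟩ := hy
    rw [mulOf_cL46]
    refine ⟨by omega, fun _ => by simp, fun h => ?_, fun h => ?_⟩
    · rcases (by omega : 2 ≤ p ∨ 2 ≤ q) with h | h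
      · simp [hx2 h]
      · simp [hy2 h]
    · rcases (by omega : 3 ≤ p ∨ 2 ≤ q) with h | h
      · simp [hx3 h]
      · simp [hy2 h]

theorem left_fails_cL46 :
    mulOf cL46 (Pi.single 1 1) (mulOf cL46 (Pi.single 1 1) (Pi.single 1 1))
      ≠ mulOf cL46 (mulOf cL46 (Pi.single 1 1) (Pi.single 1 1)) (Pi.single 1 1)
        + mulOf cL46 (Pi.single 1 1) (mulOf cL46 (Pi.single 1 1) (Pi.single 1 1)) := by
  intro h
  have := congrFun h 4
  simp [mulOf_cL46] at this

/-- `𝕃₄₆` is a nilpotent (right) Leibniz algebra (every product of 5 elements, under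
any arrangement of parentheses, vanishes), but it is not a symmetric Leibniz algebra:
the left Leibniz identity fails, e.g. at `x = y = z = e₂`. -/
theorem statement17 :
    (∀ x y z : Fin 5 → ℂ,
      mulOf cL46 (mulOf cL46 x y) z
        = mulOf cL46 (mulOf cL46 x z) y + mulOf cL46 x (mulOf cL46 y z)) ∧
    (∀ v : Fin 5 → ℂ, IsProd (mulOf cL46) 5 v → v = 0) ∧
    (∃ x y z : Fin 5 → ℂ,
      mulOf cL46 x (mulOf cL46 y z)
        ≠ mulOf cL46 (mulOf cL46 x y) z + mulOf cL46 y (mulOf cL46 x z)) ∧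
    (mulOf cL46 (Pi.single 1 1) (mulOf cL46 (Pi.single 1 1) (Pi.single 1 1))
      ≠ mulOf cL46 (mulOf cL46 (Pi.single 1 1) (Pi.single 1 1)) (Pi.single 1 1)
        + mulOf cL46 (Pi.single 1 1) (mulOf cL46 (Pi.single 1 1) (Pi.single 1 1))) := by
  refine ⟨fun x y z => ?_, fun v hv => ?_, ⟨_, _, _, left_fails_cL46⟩, left_fails_cL46⟩
  · funext k
    fin_cases k <;> simp [mulOf_cL46] <;> ring
  · obtain ⟨-, h2, h3, h4⟩ := isProd_cL46 hv
    funext k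
    fin_cases k
    · exact (h2 (by norm_num)).1
    · exact (h2 (by norm_num)).2
    · exact (h3 (by norm_num)).1
    · exact (h3 (by norm_num)).2
    · exact h4 (by norm_num)
end
end

section
/- For each t ∈ ℂ with t ≠ 0, let A_t be the 5-dimensional complex algebra with basis e₁,…,e₅ and nonzero products of basis vectors e₁e₁ = e₂, e₂e₁ = e₃, e₃e₁ = e₄, e₄e₁ = t·e₅. Then for every t ≠ 0 the algebra A_t is isomorphic to the Leibniz algebra 𝕃₈₂ (with nonzero products e₁e₁ = e₂, e₂e₁ = e₃, e₃e₁ = e₄, e₄e₁ = e₅), via the linear map fixing e₁,e₂,e₃,e₄ and sending e₅ to t⁻¹e₅; and as t → 0 the structure constants of A_t converge to the structure constants of the algebra 𝔏₁₃ ⊕ ℂ, the 5-dimensional algebra with nonzero products e₁e₁ = e₂, e₂e₁ = e₃, e₃e₁ = e₄. Consequently 𝕃₈₂ degenerates to 𝔏₁₃ ⊕ ℂ. -/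
noncomputable section

open Filter

/-- The 5-dimensional Leibniz algebra `𝕃₈₂`:
`e₁e₁ = e₂`, `e₂e₁ = e₃`, `e₃e₁ = e₄`, `e₄e₁ = e₅`. -/
def cL82 : Fin 5 → Fin 5 → Fin 5 → ℂ := fun i j k =>
  (if i = 0 ∧ j = 0 ∧ k = 1 then 1 else 0) +
  (if i = 1 ∧ j = 0 ∧ k = 2 then 1 else 0) +
  (if i = 2 ∧ j = 0 ∧ k = 3 then 1 else 0) +
  (if i = 3 ∧ j = 0 ∧ k = 4 then 1 else 0)

/-- The family `A_t`: `e₁e₁ = e₂`, `e₂e₁ = e₃`, `e₃e₁ = e₄`, `e₄e₁ = t·e₅`. -/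
def cA (t : ℂ) : Fin 5 → Fin 5 → Fin 5 → ℂ := fun i j k =>
  (if i = 0 ∧ j = 0 ∧ k = 1 then 1 else 0) +
  (if i = 1 ∧ j = 0 ∧ k = 2 then 1 else 0) +
  (if i = 2 ∧ j = 0 ∧ k = 3 then 1 else 0) +
  (if i = 3 ∧ j = 0 ∧ k = 4 then t else 0)

/-- The 5-dimensional algebra `𝔏₁₃ ⊕ ℂ`: `e₁e₁ = e₂`, `e₂e₁ = e₃`, `e₃e₁ = e₄`. -/
def cL13C : Fin 5 → Fin 5 → Fin 5 → ℂ := fun i j k =>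
  (if i = 0 ∧ j = 0 ∧ k = 1 then 1 else 0) +
  (if i = 1 ∧ j = 0 ∧ k = 2 then 1 else 0) +
  (if i = 2 ∧ j = 0 ∧ k = 3 then 1 else 0)

/-- The diagonal map fixing the first four basis vectors and scaling the last by `t⁻¹`. -/
def isoA (t : ℂ) (ht : t ≠ 0) : (Fin 5 → ℂ) ≃ₗ[ℂ] (Fin 5 → ℂ) where
  toFun x := fun k => if k = 4 then t⁻¹ * x k else x k
  invFun x := fun k => if k = 4 then t * x k else x k
  map_add' x y := by
    funext k
    by_cases h : k = 4 <;> simp [h, mul_add]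
  map_smul' c x := by
    funext k
    by_cases h : k = 4 <;> simp [h, mul_left_comm]
  left_inv x := by
    funext k
    by_cases h : k = 4 <;> simp [h, ht]
  right_inv x := by
    funext k
    by_cases h : k = 4 <;> simp [h, ht]

theorem isoA_apply (t : ℂ) (ht : t ≠ 0) (x : Fin 5 → ℂ) (k : Fin 5) :
    isoA t ht x k = if k = 4 then t⁻¹ * x k else x k := rfl

theorem isoA_mul (t : ℂ) (ht : t ≠ 0) (x y : Fin 5 → ℂ) :
    isoA t ht (mulOf (cA t) x y) = mulOf cL82 (isoA t ht x) (isoA t ht y) := by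
  funext k
  rw [isoA_apply]
  simp only [mulOf, Fin.sum_univ_five, isoA_apply, cA, cL82]
  fin_cases k <;> simp
  field_simp

theorem mulOf_single (c : Fin 5 → Fin 5 → Fin 5 → ℂ) (i j k : Fin 5) :
    mulOf c (Pi.single i 1) (Pi.single j 1) k = c i j k := by
  simp [mulOf, Pi.single_apply]

theorem tendsto_cA (i j k : Fin 5) :
    Tendsto (fun t : ℂ => cA t i j k) (nhdsWithin 0 {0}ᶜ) (nhds (cL13C i j k)) := by
  have h0 : cL13C i j k = cA 0 i j k := by simp [cA, cL13C]
  rw [h0]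
  have hc : Continuous (fun t : ℂ => cA t i j k) := by
    unfold cA
    refine continuous_const.add ?_
    split_ifs
    · exact continuous_id
    · exact continuous_const
  exact (hc.tendsto 0).mono_left nhdsWithin_le_nhds

/-- For `t ≠ 0`, `A_t ≅ 𝕃₈₂` via the map fixing `e₁,…,e₄` and sending `e₅ ↦ t⁻¹e₅`;
the structure constants of `A_t` converge to those of `𝔏₁₃ ⊕ ℂ` as `t → 0`; and
consequently `𝕃₈₂` degenerates to `𝔏₁₃ ⊕ ℂ`. -/
theorem statement19 :
    (∀ t : ℂ, t ≠ 0 → ∃ e : (Fin 5 → ℂ) ≃ₗ[ℂ] (Fin 5 → ℂ),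
      (∀ i : Fin 5, i ≠ 4 → e (Pi.single i 1) = Pi.single i 1) ∧
      e (Pi.single 4 1) = t⁻¹ • (Pi.single 4 1 : Fin 5 → ℂ) ∧
      (∀ x y : Fin 5 → ℂ, e (mulOf (cA t) x y) = mulOf cL82 (e x) (e y))) ∧
    (∀ i j k : Fin 5,
      Tendsto (fun t : ℂ => cA t i j k) (nhdsWithin 0 {0}ᶜ) (nhds (cL13C i j k))) ∧
    (∃ g : ℂ → ((Fin 5 → ℂ) ≃ₗ[ℂ] (Fin 5 → ℂ)),
      ∀ i j k : Fin 5,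
        Tendsto
          (fun t : ℂ =>
            ((g t).symm
              (mulOf cL82 (g t (Pi.single i 1)) (g t (Pi.single j 1)))) k)
          (nhdsWithin 0 {0}ᶜ) (nhds (cL13C i j k))) := by
  refine ⟨fun t ht => ⟨isoA t ht, ?_, ?_, isoA_mul t ht⟩, tendsto_cA, ?_⟩
  · intro i hi
    funext k
    rw [isoA_apply]
    by_cases h : k = 4
    · subst h
      simp [Pi.single_apply, Ne.symm hi]
    · simp [h]
  · funext k
    rw [isoA_apply]
    by_cases h : k = 4
    · subst h
      simp
    · simp [h]
  · refine ⟨fun t => if ht : t = 0 then LinearEquiv.refl ℂ _ else isoA t ht, ?_⟩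
    intro i j k
    refine (tendsto_cA i j k).congr' ?_
    filter_upwards [self_mem_nhdsWithin] with t ht
    have ht' : t ≠ 0 := ht
    simp only [ht', dite_false]
    rw [← isoA_mul, LinearEquiv.symm_apply_apply, mulOf_single]
end
end
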